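/- (Correctness of the inverted label index for nearest-neighbor queries.) Let v ∈ V and let V_C ⊆ V be the vertex set of a category. Suppose the 2-hop labeling satisfies the cover property for the pair (v, u) for every u ∈ V_C. Then ⨅_{u ∈ V_C} dis(v, u) = ⨅_{u' ∈ L_out(v)} ( dis(v, u') + ⨅_{u ∈ V_C, u' ∈ L_in(u)} dis(u', u) ); i.e., the least cost from v to a vertex of the category is obtained by combining, for each label vertex u' ∈ L_out(v), the stored distance dis(v,u') with a least-cost entry of the inverted label of u' for the category. -/

import Mathlib

open scoped ENNReal

noncomputable def routeCost {V : Type*} (W : V → V → ℝ≥0∞) : List V → ℝ≥0∞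
  | [] => 0
  | [_] => 0
  | u :: v :: rest => W u v + routeCost W (v :: rest)

/-- The least cost from `u` to `v`: the infimum, over all routes (nonempty vertex
lists starting at `u` and ending at `v`), of their costs. -/
noncomputable def dis {V : Type*} (W : V → V → ℝ≥0∞) (u v : V) : ℝ≥0∞ :=
  ⨅ l ∈ {l : List V | l.head? = some u ∧ l.getLast? = some v}, routeCost W l

theorem dis_le_edge_add_dis {V : Type*} (W : V → V → ℝ≥0∞) (u v w : V) :
    dis W u w ≤ W u v + dis W v w := by
  rw [dis.eq_def W v w]
  simp only [ENNReal.add_iInf]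
  refine le_iInf₂ fun l hl => ?_
  obtain ⟨hhead, hlast⟩ := hl
  match l, hhead, hlast with
  | x :: t, hhead, hlast =>
    obtain rfl : x = v := by simpa using hhead
    exact iInf₂_le (u :: x :: t) ⟨rfl, by rwa [List.getLast?_cons_cons]⟩

theorem dis_le_routeCost_add_dis {V : Type*} (W : V → V → ℝ≥0∞) (v w : V) :
    ∀ (l : List V) (u : V), l.head? = some u → l.getLast? = some v →
      dis W u w ≤ routeCost W l + dis W v w
  | [], _, hhead, _ => by simp at hhead
  | [x], u, hhead, hlast => by
    obtain rfl : x = u := by simpa using hhead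
    obtain rfl : x = v := by simpa using hlast
    exact le_add_self
  | x :: y :: t, u, hhead, hlast => by
    obtain rfl : x = u := by simpa using hhead
    rw [List.getLast?_cons_cons] at hlast
    calc dis W x w ≤ W x y + dis W y w := dis_le_edge_add_dis W x y w
      _ ≤ W x y + (routeCost W (y :: t) + dis W v w) := by
        gcongr
        exact dis_le_routeCost_add_dis W v w (y :: t) y rfl hlast
      _ = routeCost W (x :: y :: t) + dis W v w := by rw [routeCost, add_assoc]

theorem dis_triangle {V : Type*} (W : V → V → ℝ≥0∞) (u v w : V) :
    dis W u w ≤ dis W u v + dis W v w := by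
  rw [dis.eq_def W u v]
  simp only [ENNReal.iInf_add]
  exact le_iInf₂ fun l hl => dis_le_routeCost_add_dis W v w l u hl.1 hl.2

/-- Correctness of the inverted label index for nearest-neighbor
queries: if the labeling covers the pair `(v, u)` for every vertex `u` of the
category `V_C`, then the least cost from `v` to a vertex of the category equals the
combination, over label vertices `u' ∈ L_out(v)`, of the stored distance `dis(v,u')`
with a least-cost entry of the inverted label of `u'` for the category. -/
theorem inverted_label_correct {V : Type*} (W : V → V → ℝ≥0∞)
    (Lout Lin : V → Set V) (v : V) (VC : Set V)
    (hcover : ∀ u ∈ VC, ∃ u' ∈ Lout v ∩ Lin u, dis W v u' + dis W u' u = dis W v u) :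
    (⨅ u ∈ VC, dis W v u) =
      ⨅ u' ∈ Lout v, (dis W v u' + ⨅ u ∈ {u | u ∈ VC ∧ u' ∈ Lin u}, dis W u' u) := by
  apply le_antisymm
  · simp only [ENNReal.add_iInf]
    exact le_iInf₂ fun u' _ => le_iInf₂ fun u hu =>
      (iInf₂_le u hu.1).trans (dis_triangle W v u' u)
  · refine le_iInf₂ fun u hu => ?_
    obtain ⟨u', ⟨hout, hin⟩, heq⟩ := hcover u hu
    rw [← heq]
    refine (iInf₂_le u' hout).trans ?_
    gcongr
    exact iInf₂_le u ⟨hu, hin⟩
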